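/- arXiv:0811.3410 — 2 statements merged into one kernel-verified Lean document; each statement's English description precedes it below -/
import Mathlib

section
/- Let B be a ZMod 2-submodule of (Fin N → ZMod 2), and let C and D be doubly even submodules of B that are maximal doubly even subcodes of B, meaning: C is doubly even, and any doubly even submodule of B containing C equals C (and likewise for D). Then finrank C = finrank D. -/
/-- The Hamming weight of a vector over `ZMod 2`. -/
def wt {N : ℕ} (x : Fin N → ZMod 2) : ℕ :=
  (Finset.univ.filter (fun i => x i ≠ 0)).card

/-- The number of coordinates in which both `x` and `y` are nonzero. -/
def overlap {N : ℕ} (x y : Fin N → ZMod 2) : ℕ :=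
  (Finset.univ.filter (fun i => x i ≠ 0 ∧ y i ≠ 0)).card

theorem wt_add_add_two_mul_overlap {N : ℕ} (x y : Fin N → ZMod 2) :
    wt (x + y) + 2 * overlap x y = wt x + wt y := by
  simp only [wt, overlap, Finset.card_filter, Finset.mul_sum, ← Finset.sum_add_distrib,
    Pi.add_apply]
  refine Finset.sum_congr rfl fun i _ => ?_
  generalize x i = a
  generalize y i = b
  revert a b
  decide

theorem dotProduct_eq_overlap {N : ℕ} (x y : Fin N → ZMod 2) :
    x ⬝ᵥ y = (overlap x y : ZMod 2) := by
  simp only [dotProduct, overlap, Finset.card_filter, Nat.cast_sum]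
  refine Finset.sum_congr rfl fun i _ => ?_
  generalize x i = a
  generalize y i = b
  revert a b
  decide

theorem dotProduct_eq_zero_iff_two_dvd_overlap {N : ℕ} (x y : Fin N → ZMod 2) :
    x ⬝ᵥ y = 0 ↔ 2 ∣ overlap x y := by
  rw [dotProduct_eq_overlap, ZMod.natCast_eq_zero_iff]

theorem dotProduct_eq_zero_of_doublyEven {N : ℕ}
    {C : Submodule (ZMod 2) (Fin N → ZMod 2)} (hC : ∀ x ∈ C, 4 ∣ wt x)
    {x y : Fin N → ZMod 2} (hx : x ∈ C) (hy : y ∈ C) : x ⬝ᵥ y = 0 := by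
  rw [dotProduct_eq_zero_iff_two_dvd_overlap]
  have h := wt_add_add_two_mul_overlap x y
  have hxC := hC x hx
  have hyC := hC y hy
  have hxyC := hC _ (C.add_mem hx hy)
  omega

/-- If `dim C < dim D` and `D` is self-orthogonal, then some vector of `D` outside `C` is
orthogonal to `C`. -/
theorem exists_mem_notMem_dotProduct_eq_zero {K ι : Type*} [Field K] [Fintype ι]
    {C D : Submodule K (ι → K)} (hD : ∀ x ∈ D, ∀ y ∈ D, x ⬝ᵥ y = 0)
    (hlt : Module.finrank K C < Module.finrank K D) :
    ∃ x ∈ D, x ∉ C ∧ ∀ c ∈ C, x ⬝ᵥ c = 0 := by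
  by_contra! hcon
  let f : D →ₗ[K] Module.Dual K C :=
    (dotProductBilin K K).domRestrict₁₂ D C
  have hf (x : D) (c : C) : f x c = (x : ι → K) ⬝ᵥ (c : ι → K) := rfl
  have hrange : LinearMap.range f ≤ (D.comap C.subtype).dualAnnihilator := by
    rintro _ ⟨x, rfl⟩
    rw [Submodule.mem_dualAnnihilator]
    exact fun c hc => hD x x.2 c hc
  have hker : LinearMap.ker f ≤ C.comap D.subtype := by
    intro x hx
    by_contra hxC
    obtain ⟨c, hc, hne⟩ := hcon x x.2 hxC
    exact hne (by simpa [hf] using LinearMap.congr_fun (LinearMap.mem_ker.mp hx) ⟨c, hc⟩)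
  have h₁ := Submodule.finrank_mono hrange
  have h₂ := Submodule.finrank_mono hker
  have h₃ := f.finrank_range_add_finrank_ker
  have h₄ := Subspace.finrank_add_finrank_dualAnnihilator_eq (D.comap C.subtype)
  have h₅ : Module.finrank K (D.comap C.subtype) = Module.finrank K (C.comap D.subtype) := by
    rw [← Submodule.finrank_map_subtype_eq C, ← Submodule.finrank_map_subtype_eq D,
      Submodule.map_comap_subtype, Submodule.map_comap_subtype, inf_comm]
  omega

theorem finrank_le_of_maximal_doublyEven {N : ℕ}
    {B C D : Submodule (ZMod 2) (Fin N → ZMod 2)}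
    (hCB : C ≤ B) (hDB : D ≤ B)
    (hC : ∀ x ∈ C, 4 ∣ wt x) (hD : ∀ x ∈ D, 4 ∣ wt x)
    (hCmax : ∀ C' : Submodule (ZMod 2) (Fin N → ZMod 2),
      C' ≤ B → (∀ x ∈ C', 4 ∣ wt x) → C ≤ C' → C' = C) :
    Module.finrank (ZMod 2) D ≤ Module.finrank (ZMod 2) C := by
  by_contra! hlt
  obtain ⟨x, hxD, hxC, horth⟩ := exists_mem_notMem_dotProduct_eq_zero
    (fun x hx y hy => dotProduct_eq_zero_of_doublyEven hD hx hy) hlt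
  have hmax : C ⊔ Submodule.span (ZMod 2) {x} = C := by
    refine hCmax _ (sup_le hCB ?_) ?_ le_sup_left
    · simpa using hDB hxD
    · intro z hz
      obtain ⟨c, hc, y, hy, rfl⟩ := Submodule.mem_sup.mp hz
      obtain ⟨a, rfl⟩ := Submodule.mem_span_singleton.mp hy
      have hax := hD _ (D.smul_mem a hxD)
      have hov : 2 ∣ overlap (a • x) c := by
        rw [← dotProduct_eq_zero_iff_two_dvd_overlap, smul_dotProduct, horth c hc, smul_zero]
      have h := wt_add_add_two_mul_overlap (a • x) c
      have hcC := hC c hc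
      rw [add_comm c]
      omega
  exact hxC (hmax ▸ Submodule.mem_sup_right (Submodule.mem_span_singleton_self x))

/-- Any two maximal doubly even subcodes of a binary linear code `B` have the same
dimension. -/
theorem maximal_doublyEven_finrank_eq {N : ℕ}
    (B C D : Submodule (ZMod 2) (Fin N → ZMod 2))
    (hCB : C ≤ B) (hDB : D ≤ B)
    (hC : ∀ x ∈ C, 4 ∣ wt x) (hD : ∀ x ∈ D, 4 ∣ wt x)
    (hCmax : ∀ C' : Submodule (ZMod 2) (Fin N → ZMod 2),
      C' ≤ B → (∀ x ∈ C', 4 ∣ wt x) → C ≤ C' → C' = C)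
    (hDmax : ∀ D' : Submodule (ZMod 2) (Fin N → ZMod 2),
      D' ≤ B → (∀ x ∈ D', 4 ∣ wt x) → D ≤ D' → D' = D) :
    Module.finrank (ZMod 2) C = Module.finrank (ZMod 2) D := by
  exact le_antisymm (finrank_le_of_maximal_doublyEven hDB hCB hD hC hDmax)
    (finrank_le_of_maximal_doublyEven hCB hDB hC hD hCmax)
end

section
/- Let c : Fin k → (Fin N → ZMod 2) be a linearly independent family of vectors such that each c i has weight divisible by 4 and any two distinct ones are orthogonal (⟨c i, c j⟩ = 0 for i ≠ j). Let s_i be the support of c i and set e₀ := ∏_{i=0}^{k−1} ((1/2 : ℝ) • (1 + g_{s_i})) in Cl(0,N) (the factors pairwise commute). Then the ℝ-linear map on Cl(0,N) given by right multiplication by e₀, v ↦ v * e₀, has range of ℝ-dimension (finrank) equal to 2^(N−k). -/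
/-- The standard positive-definite quadratic form on `Fin N → ℝ`, `Q x = ∑ i, (x i)^2`. -/
noncomputable def stdQ (N : ℕ) : QuadraticForm ℝ (Fin N → ℝ) :=
  QuadraticMap.weightedSumSquares ℝ (fun _ : Fin N => (1 : ℝ))

/-- The generator `Γ_i` of the Clifford algebra `Cl(0,N)`. -/
noncomputable def Γ {N : ℕ} (i : Fin N) : CliffordAlgebra (stdQ N) :=
  CliffordAlgebra.ι (stdQ N) (Pi.single i 1)

/-- The Clifford monomial `g_s`: the product of the `Γ_i` for `i ∈ s`, in increasing
order of index. -/
noncomputable def gMon {N : ℕ} (s : Finset (Fin N)) : CliffordAlgebra (stdQ N) :=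
  ((s.sort (· ≤ ·)).map Γ).prod

/-- The support of a vector over `ZMod 2`: the finset of coordinates where it is nonzero. -/
def supp {N : ℕ} (x : Fin N → ZMod 2) : Finset (Fin N) :=
  Finset.univ.filter (fun i => x i ≠ 0)

section Projections

variable {K A : Type*} [Field K] [Ring A] [Algebra K A] [FiniteDimensional K A]

/-- If an idempotent `p` commutes with `e`, and a unit commuting with `e` intertwines `p` with
`1 - p`, then multiplying by `p` halves the dimension of the range of right multiplication
by `e`. -/
lemma finrank_range_mulRight_eq_two_mul {e p a : A} (hp : IsIdempotentElem p)
    (hep : Commute e p) (ha : IsUnit a) (hea : Commute e a) (hpa : p * a = a * (1 - p)) :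
    Module.finrank K (LinearMap.range (LinearMap.mulRight K e)) =
      2 * Module.finrank K (LinearMap.range (LinearMap.mulRight K (e * p))) := by
  have hq : p * (1 - p) = 0 := by rw [mul_sub, mul_one, hp.eq, sub_self]
  have hq' : (1 - p) * p = 0 := by rw [sub_mul, one_mul, hp.eq, sub_self]
  have hsup : LinearMap.range (LinearMap.mulRight K (e * p)) ⊔
      LinearMap.range (LinearMap.mulRight K (e * (1 - p))) =
        LinearMap.range (LinearMap.mulRight K e) := by
    refine le_antisymm (sup_le ?_ ?_) ?_
    · rintro _ ⟨v, rfl⟩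
      exact ⟨v * p, by simp [mul_assoc, hep.eq]⟩
    · rintro _ ⟨v, rfl⟩
      exact ⟨v * (1 - p), by simp [mul_assoc, ((Commute.one_right e).sub_right hep).eq]⟩
    · rintro _ ⟨v, rfl⟩
      refine Submodule.mem_sup.2 ⟨_, ⟨v, rfl⟩, _, ⟨v, rfl⟩, ?_⟩
      simp [← mul_add]
  have hinf : LinearMap.range (LinearMap.mulRight K (e * p)) ⊓
      LinearMap.range (LinearMap.mulRight K (e * (1 - p))) = ⊥ := by
    rw [eq_bot_iff]
    rintro x ⟨⟨u, hu⟩, ⟨w, hw⟩⟩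
    simp only [LinearMap.mulRight_apply] at hu hw
    have h₁ : x * p = x := by rw [← hu, mul_assoc, mul_assoc, hp.eq]
    have h₂ : x * p = 0 := by rw [← hw, mul_assoc, mul_assoc, hq', mul_zero, mul_zero]
    rw [Submodule.mem_bot, ← h₁, h₂]
  obtain ⟨a, rfl⟩ := ha
  let f : A ≃ₗ[K] A := LinearEquiv.ofBijective (LinearMap.mulRight K (a : A)) a.mulRight_bijective
  have hf : ∀ v, f v = v * a := fun _ => rfl
  have hswap : ∀ v, v * a * (e * (1 - p)) = v * (e * p) * a := fun v => by
    simp only [mul_assoc]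
    rw [hpa, ← mul_assoc (a : A) e, ← hea.eq, mul_assoc]
  have hmap : (LinearMap.range (LinearMap.mulRight K (e * p))).map (f : A →ₗ[K] A) =
      LinearMap.range (LinearMap.mulRight K (e * (1 - p))) := by
    ext x
    constructor
    · rintro ⟨_, ⟨v, rfl⟩, rfl⟩
      exact ⟨v * a, hswap v⟩
    · rintro ⟨v, rfl⟩
      obtain ⟨w, rfl⟩ := f.surjective v
      exact ⟨_, ⟨w, rfl⟩, (hswap w).symm⟩
  have h := Submodule.finrank_sup_add_finrank_inf_eq
    (LinearMap.range (LinearMap.mulRight K (e * p)))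
    (LinearMap.range (LinearMap.mulRight K (e * (1 - p))))
  rw [hsup, hinf, finrank_bot, ← hmap, LinearEquiv.finrank_map_eq] at h
  omega

/-- Commuting involutions `g i`, each of which can be negated by conjugation with a unit commuting
with the others, project onto a left ideal whose dimension is that of `A` divided by `2 ^ k`. -/
lemma two_pow_mul_finrank_range_mulRight_prod (h2 : (2 : K) ≠ 0) {k : ℕ} (g a : Fin k → A)
    (hsq : ∀ i, g i * g i = 1) (hcomm : ∀ i j, Commute (g i) (g j)) (ha : ∀ i, IsUnit (a i))
    (hne : ∀ i j, i ≠ j → Commute (g i) (a j)) (heq : ∀ i, g i * a i = -(a i * g i)) :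
    2 ^ k * Module.finrank K (LinearMap.range (LinearMap.mulRight K
      (List.ofFn fun i => (1 / 2 : K) • (1 + g i)).prod)) = Module.finrank K A := by
  induction k with
  | zero =>
    rw [List.ofFn_zero, List.prod_nil, LinearMap.mulRight_one, LinearMap.range_id, finrank_top,
      pow_zero, one_mul]
  | succ k ih =>
    rw [List.ofFn_succ, List.prod_cons]
    have hprod : ∀ x, (∀ i : Fin k, Commute (g i.succ) x) →
        Commute (List.ofFn fun i : Fin k => (1 / 2 : K) • (1 + g i.succ)).prod x := by
      intro x hx
      refine Commute.list_prod_left _ _ fun y hy => ?_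
      obtain ⟨i, rfl⟩ := (List.mem_ofFn' _ _).1 hy
      exact ((Commute.one_left x).add_left (hx i)).smul_left _
    have hcp := hprod ((1 / 2 : K) • (1 + g 0)) fun i =>
      ((Commute.one_right _).add_right (hcomm _ _)).smul_right _
    rw [← hcp.eq, pow_succ, mul_assoc, ← finrank_range_mulRight_eq_two_mul (a := a 0) ?_ hcp (ha 0)
      (hprod _ fun i => hne _ _ i.succ_ne_zero) ?_]
    · exact ih (fun i => g i.succ) (fun i => a i.succ) (fun i => hsq _) (fun i j => hcomm _ _)
        (fun i => ha _) (fun i j hij => hne _ _ (by simpa using hij)) (fun i => heq _)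
    · have : (1 + g 0) * (1 + g 0) = (2 : K) • (1 + g 0) := by
        rw [mul_add, add_mul, add_mul, hsq, two_smul]
        simp only [mul_one, one_mul]
        abel
      rw [IsIdempotentElem, smul_mul_smul_comm, this, smul_smul]
      congr 1
      field_simp
    · have h : 1 - (1 / 2 : K) • (1 + g 0) = (1 / 2 : K) • (1 - g 0) := by
        rw [sub_eq_iff_eq_add, ← smul_add, show (1 - g 0) + (1 + g 0) = 1 + 1 by abel,
          ← two_smul K (1 : A), smul_smul, one_div_mul_cancel h2, one_smul]
      rw [h, smul_mul_assoc, mul_smul_comm, add_mul, heq, mul_sub, one_mul, mul_one,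
        sub_eq_add_neg]

end Projections

section Clifford

variable {N : ℕ}

lemma Γ_mul_self (i : Fin N) : Γ i * Γ i = 1 := by
  rw [Γ, CliffordAlgebra.ι_sq_scalar, stdQ, QuadraticMap.weightedSumSquares_apply]
  simp [Pi.single_apply]

lemma Γ_mul_Γ_of_ne {i j : Fin N} (h : i ≠ j) : Γ i * Γ j = -(Γ j * Γ i) := by
  refine CliffordAlgebra.ι_mul_ι_comm_of_isOrtho ?_
  simp only [QuadraticMap.isOrtho_def, stdQ, QuadraticMap.weightedSumSquares_apply, one_smul,
    ← Finset.sum_add_distrib]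
  refine Finset.sum_congr rfl fun l _ => ?_
  by_cases hi : l = i
  · subst hi
    simp [h]
  · simp [hi]

lemma Γ_mul_list_prod (i : Fin N) (l : List (Fin N)) :
    Γ i * (l.map Γ).prod = (-1 : ℝ) ^ (l.length + l.count i) • ((l.map Γ).prod * Γ i) := by
  induction l with
  | nil => simp
  | cons j l ih =>
    rw [List.map_cons, List.prod_cons, List.length_cons]
    by_cases h : j = i
    · subst h
      rw [List.count_cons_self, mul_assoc, ← mul_smul_comm, show
        l.length + 1 + (l.count j + 1) = l.length + l.count j + 2 by ring, pow_add,
        neg_one_sq, mul_one, ← ih]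
    · rw [List.count_cons_of_ne h, ← mul_assoc, Γ_mul_Γ_of_ne (Ne.symm h), neg_mul, mul_assoc, ih,
        mul_smul_comm, ← mul_assoc, add_right_comm, pow_succ, mul_neg_one, neg_smul]

lemma list_prod_mul_self {l : List (Fin N)} (hl : l.Nodup) :
    (l.map Γ).prod * (l.map Γ).prod = (-1 : ℝ) ^ l.length.choose 2 • 1 := by
  induction l with
  | nil => simp
  | cons i l ih =>
    obtain ⟨hi, hl⟩ := List.nodup_cons.1 hl
    have h := Γ_mul_list_prod i l
    rw [List.count_eq_zero_of_not_mem hi, add_zero] at h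
    rw [List.map_cons, List.prod_cons]
    nth_rw 1 [h]
    rw [smul_mul_assoc, mul_assoc, ← mul_assoc (Γ i), Γ_mul_self, one_mul, ih hl, smul_smul,
      ← pow_add, List.length_cons, Nat.choose_succ_succ' _ 1, Nat.choose_one_right]

lemma gMon_mul_self {s : Finset (Fin N)} (hs : 4 ∣ s.card) : gMon s * gMon s = 1 := by
  obtain ⟨m, hm⟩ := hs
  have h : Even (s.card.choose 2) := by
    rw [hm, Nat.choose_two_right, show 4 * m * (4 * m - 1) = 2 * (2 * (m * (4 * m - 1))) by ring,
      Nat.mul_div_cancel_left _ two_pos]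
    exact even_two_mul _
  rw [gMon, list_prod_mul_self (s.sort_nodup _), Finset.length_sort, h.neg_one_pow, one_smul]

lemma isUnit_gMon (s : Finset (Fin N)) : IsUnit (gMon s) := by
  refine List.prod_isUnit fun x hx => ?_
  obtain ⟨i, -, rfl⟩ := List.mem_map.1 hx
  exact ⟨⟨Γ i, Γ i, Γ_mul_self i, Γ_mul_self i⟩, rfl⟩

lemma list_prod_mul_gMon (l : List (Fin N)) {s : Finset (Fin N)} (hs : Even s.card) :
    (l.map Γ).prod * gMon s = (-1 : ℝ) ^ l.countP (· ∈ s) • (gMon s * (l.map Γ).prod) := by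
  induction l with
  | nil => simp
  | cons i l ih =>
    have h : Γ i * gMon s = (-1 : ℝ) ^ (if i ∈ s then 1 else 0) • (gMon s * Γ i) := by
      rw [gMon, Γ_mul_list_prod, Finset.length_sort, pow_add, hs.neg_one_pow, one_mul,
        List.Nodup.count (s.sort_nodup _)]
      simp only [Finset.mem_sort]
    rw [List.map_cons, List.prod_cons, mul_assoc, ih, mul_smul_comm, ← mul_assoc, h,
      smul_mul_assoc, smul_smul, ← pow_add, mul_assoc, List.countP_cons]
    simp only [decide_eq_true_eq]

lemma gMon_mul_gMon {s t : Finset (Fin N)} (hs : Even s.card) :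
    gMon t * gMon s = (-1 : ℝ) ^ (t ∩ s).card • (gMon s * gMon t) := by
  rw [gMon, list_prod_mul_gMon _ hs, ← Finset.filter_mem_eq_inter, List.countP_eq_length_filter,
    ← List.toFinset_card_of_nodup ((t.sort_nodup _).filter _), List.toFinset_filter,
    Finset.sort_toFinset]
  simp only [decide_eq_true_eq]

lemma natCast_card_supp_inter (x y : Fin N → ZMod 2) :
    ((supp x ∩ supp y).card : ZMod 2) = ∑ l, x l * y l := by
  have h : ∀ a b : ZMod 2, (if a ≠ 0 ∧ b ≠ 0 then 1 else 0) = a * b := by decide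
  simp only [supp, ← Finset.filter_and, Finset.card_filter, Nat.cast_sum, Nat.cast_ite,
    Nat.cast_one, Nat.cast_zero, h]

lemma finrank_cliffordAlgebra_stdQ (N : ℕ) :
    Module.finrank ℝ (CliffordAlgebra (stdQ N)) = 2 ^ N := by
  rw [(CliffordAlgebra.equivExterior (stdQ N)).finrank_eq,
    Module.finrank_eq_card_basis (Pi.basisFun ℝ (Fin N)).ExteriorAlgebra, Fintype.card_finset,
    Fintype.card_fin]

end Clifford

lemma LinearIndependent.exists_dual_vectors {K ι n : Type*} [Field K] [Fintype ι] [DecidableEq ι]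
    [Fintype n] {c : ι → n → K} (hc : LinearIndependent K c) :
    ∃ x : ι → n → K, ∀ i j, ∑ l, c i l * x j l = if i = j then 1 else 0 := by
  classical
  obtain ⟨g, hg⟩ := (Fintype.linearCombination K c).exists_leftInverse_of_injective
    (LinearMap.ker_eq_bot.2 (hc.fintypeLinearCombination_injective))
  refine ⟨fun j l => g (fun m => if l = m then 1 else 0) j, fun i j => ?_⟩
  have h := congrFun (LinearMap.congr_fun hg (Pi.single i 1)) j
  rw [LinearMap.comp_apply, Fintype.linearCombination_apply_single, one_smul,
    LinearMap.pi_apply_eq_sum_univ] at h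
  simpa [Pi.single_apply, eq_comm] using h

/-- For a linearly independent family `c` of pairwise orthogonal vectors of weight
divisible by 4, right multiplication by `e₀ = ∏ (1 + g_{supp (c i)})/2` has range of
dimension `2^(N - k)`. -/
theorem finrank_range_mulRight_projector {N k : ℕ} (c : Fin k → (Fin N → ZMod 2))
    (hc : LinearIndependent (ZMod 2) c)
    (hwt : ∀ i, 4 ∣ wt (c i))
    (horth : ∀ i j, i ≠ j → ∑ l, c i l * c j l = 0) :
    Module.finrank ℝ
      (LinearMap.range (LinearMap.mulRight ℝ
        ((List.ofFn (fun i : Fin k =>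
          (1 / 2 : ℝ) • ((1 : CliffordAlgebra (stdQ N)) + gMon (supp (c i))))).prod)))
      = 2 ^ (N - k) := by
  have : FiniteDimensional ℝ (CliffordAlgebra (stdQ N)) :=
    Module.finite_of_finrank_pos (by rw [finrank_cliffordAlgebra_stdQ]; positivity)
  have heven : ∀ i, Even (supp (c i)).card := fun i =>
    even_iff_two_dvd.2 ((by norm_num : 2 ∣ 4).trans (hwt i))
  obtain ⟨x, hx⟩ := hc.exists_dual_vectors
  have hcomm : ∀ y i, ∑ l, c i l * y l = 0 → Commute (gMon (supp (c i))) (gMon (supp y)) := by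
    intro y i h
    rw [← natCast_card_supp_inter, ZMod.natCast_eq_zero_iff_even, Finset.inter_comm] at h
    rw [Commute.symm_iff, Commute, SemiconjBy, gMon_mul_gMon (heven i), h.neg_one_pow, one_smul]
  have hanti : ∀ i, gMon (supp (c i)) * gMon (supp (x i)) =
      -(gMon (supp (x i)) * gMon (supp (c i))) := by
    intro i
    have h := hx i i
    rw [if_pos rfl, ← natCast_card_supp_inter, ZMod.natCast_eq_one_iff_odd,
      Finset.inter_comm] at h
    rw [gMon_mul_gMon (heven i) (t := supp (x i)), h.neg_one_pow, neg_one_smul, neg_neg]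
  have h := two_pow_mul_finrank_range_mulRight_prod (two_ne_zero (α := ℝ))
    (fun i => gMon (supp (c i))) (fun i => gMon (supp (x i)))
    (fun i => gMon_mul_self (hwt i))
    (fun i j => by
      by_cases hij : i = j
      · rw [hij]
      · exact hcomm _ _ (horth i j hij))
    (fun i => isUnit_gMon _)
    (fun i j hij => hcomm _ _ (by rw [hx, if_neg hij]))
    hanti
  have hk : k ≤ N := by simpa using hc.fintype_card_le_finrank
  rw [finrank_cliffordAlgebra_stdQ, ← pow_mul_pow_sub 2 hk] at h
  exact Nat.eq_of_mul_eq_mul_left (by positivity) h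
end
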